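/- Let U be an orbifold atlas of dimension n on X and let (λ_ih, x̃_i, λ_ij) and (λ_kj, x̃_k, λ_kl) be triples in R̂ with λ_ij(x̃_i) = λ_kj(x̃_k) in Ũ_j. Call a completion of this pair any datum of a chart (Ũ_f, G_f, π_f) of U, a point x̃_f ∈ Ũ_f and embeddings λ_fi : (Ũ_f,G_f,π_f) → (Ũ_i,G_i,π_i), λ_fk : (Ũ_f,G_f,π_f) → (Ũ_k,G_k,π_k) with λ_ij ∘ λ_fi = λ_kj ∘ λ_fk, λ_fi(x̃_f) = x̃_i and λ_fk(x̃_f) = x̃_k. Then: (i) the ∼-class of (λ_ih ∘ λ_fi, x̃_f, λ_kl ∘ λ_fk) is the same for every completion; and (ii) this class depends only on the ∼-classes of the two given triples (replacing either triple by a ∼-equivalent triple yields the same class). Hence the multiplication m([λ_ih, x̃_i, λ_ij], [λ_kj, x̃_k, λ_kl]) := [λ_ih ∘ λ_fi, x̃_f, λ_kl ∘ λ_fk] is a well-defined map on composable pairs of classes in R := R̂/∼. -/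

import Mathlib

open Set

noncomputable section

/-- `ℂⁿ`. -/
abbrev CC (n : ℕ) : Type := EuclideanSpace ℂ (Fin n)

/-- A (reduced complex) uniformizing system of dimension `n` for the open set
`U := p '' Ut` of `X`: `Ut ⊆ ℂⁿ` is a nonempty connected open set, `G` is a finite
group of holomorphic automorphisms of `Ut` (encoded as total maps that agree with the
identity outside `Ut`, so that `G` is honestly a set of maps closed under composition
and inversion), and `p` (the map `π`) is continuous, surjective and `G`-invariant on
`Ut`, inducing a homeomorphism `Ut/G ≃ U` (encoded by: the fibres of `p` on `Ut` are
exactly the `G`-orbits and `p` is an open map on `Ut`). -/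
structure UniformizingSystem (n : ℕ) (X : Type*) [TopologicalSpace X] where
  Ut : Set (CC n)
  isOpen_Ut : IsOpen Ut
  isConnected_Ut : IsConnected Ut
  G : Set (CC n → CC n)
  finite_G : G.Finite
  id_mem_G : (id : CC n → CC n) ∈ G
  comp_mem_G : ∀ g ∈ G, ∀ h ∈ G, (g ∘ h) ∈ G
  inv_mem_G : ∀ g ∈ G, ∃ g' ∈ G, (∀ x, g' (g x) = x) ∧ (∀ x, g (g' x) = x)
  mapsTo_G : ∀ g ∈ G, Set.MapsTo g Ut Ut
  eqOn_id_G : ∀ g ∈ G, Set.EqOn g id Utᶜ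
  analytic_G : ∀ g ∈ G, AnalyticOnNhd ℂ g Ut
  p : CC n → X
  continuousOn_p : ContinuousOn p Ut
  isOpen_image_p : IsOpen (p '' Ut)
  invariant_p : ∀ g ∈ G, ∀ x ∈ Ut, p (g x) = p x
  exists_g_of_p_eq : ∀ x ∈ Ut, ∀ y ∈ Ut, p x = p y → ∃ g ∈ G, g x = y
  isOpenMap_p : ∀ V : Set (CC n), V ⊆ Ut → IsOpen V → IsOpen (p '' V)

/-- The underlying open subset of `X` uniformized by the system. -/
def UniformizingSystem.U {n : ℕ} {X : Type*} [TopologicalSpace X]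
    (𝒰 : UniformizingSystem n X) : Set X := 𝒰.p '' 𝒰.Ut

/-- An embedding `l : (Ũ,G,π) → (Ṽ,H,φ)` of uniformizing systems: a holomorphic
embedding (injective, biholomorphism onto its open image) with `φ ∘ l = π` on `Ũ`. -/
structure IsUSEmbedding {n : ℕ} {X : Type*} [TopologicalSpace X]
    (𝒰 𝒱 : UniformizingSystem n X) (l : CC n → CC n) : Prop where
  mapsTo : Set.MapsTo l 𝒰.Ut 𝒱.Ut
  injOn : Set.InjOn l 𝒰.Ut
  analyticOn : AnalyticOnNhd ℂ l 𝒰.Ut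
  isOpen_image : IsOpen (l '' 𝒰.Ut)
  exists_analytic_inv : ∃ m : CC n → CC n,
    AnalyticOnNhd ℂ m (l '' 𝒰.Ut) ∧ ∀ x ∈ 𝒰.Ut, m (l x) = x
  comp_p : ∀ x ∈ 𝒰.Ut, 𝒱.p (l x) = 𝒰.p x

/-- A (reduced complex) orbifold atlas of dimension `n` on `X`: a family of
uniformizing systems whose underlying open sets cover `X`, such that any two charts
are compatible at every point of the intersection of their underlying open sets. -/
structure OrbifoldAtlas (n : ℕ) (X : Type*) [TopologicalSpace X] where
  I : Type
  chart : I → UniformizingSystem n X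
  covers : ∀ x : X, ∃ i : I, x ∈ (chart i).U
  compat : ∀ i j : I, ∀ x ∈ (chart i).U ∩ (chart j).U,
    ∃ k : I, x ∈ (chart k).U ∧ (chart k).U ⊆ (chart i).U ∩ (chart j).U ∧
      (∃ l, IsUSEmbedding (chart k) (chart i) l) ∧
      (∃ l, IsUSEmbedding (chart k) (chart j) l)

/-- An element of the set `R̂` associated to an orbifold atlas `𝒰`: a triple
`(λ_ki, x̃_k, λ_kj)` consisting of a chart `(Ũ_k, G_k, π_k)` of `𝒰`, a point
`x̃_k ∈ Ũ_k`, and two embeddings of this chart into charts of `𝒰`. -/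
structure RHat {n : ℕ} {X : Type*} [TopologicalSpace X] (𝒰 : OrbifoldAtlas n X) where
  k : 𝒰.I
  i : 𝒰.I
  j : 𝒰.I
  x : CC n
  hx : x ∈ (𝒰.chart k).Ut
  li : CC n → CC n
  lj : CC n → CC n
  hli : IsUSEmbedding (𝒰.chart k) (𝒰.chart i) li
  hlj : IsUSEmbedding (𝒰.chart k) (𝒰.chart j) lj

/-- The relation `∼` on `R̂`: two triples (with the same pairs of target charts) are
related iff there are a chart `(Ũ_m, G_m, π_m)`, a point `x̃_m ∈ Ũ_m` and embeddings
`λ_mk, λ_ml` making the two diagrams (of embeddings and of marked points) commute.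
Triples whose targets have different index pairs are declared not related. -/
def RRel {n : ℕ} {X : Type*} [TopologicalSpace X] (𝒰 : OrbifoldAtlas n X)
    (a b : RHat 𝒰) : Prop :=
  a.i = b.i ∧ a.j = b.j ∧
  ∃ (m : 𝒰.I) (xm : CC n) (_ : xm ∈ (𝒰.chart m).Ut) (mk ml : CC n → CC n),
    IsUSEmbedding (𝒰.chart m) (𝒰.chart a.k) mk ∧
    IsUSEmbedding (𝒰.chart m) (𝒰.chart b.k) ml ∧
    (∀ y ∈ (𝒰.chart m).Ut, a.li (mk y) = b.li (ml y)) ∧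
    (∀ y ∈ (𝒰.chart m).Ut, a.lj (mk y) = b.lj (ml y)) ∧
    mk xm = a.x ∧ ml xm = b.x

/-- `r` is (a representative of) the product of the composable triples `a` and `b`,
obtained from a completion: a chart `Ũ_f := Ũ_{r.k}` with a point `x̃_f := r.x` and
embeddings `λ_fi, λ_fk` with `λ_ij ∘ λ_fi = λ_kj ∘ λ_fk`, `λ_fi(x̃_f) = x̃_i`,
`λ_fk(x̃_f) = x̃_k`, the product triple being `(λ_ih ∘ λ_fi, x̃_f, λ_kl ∘ λ_fk)`. -/
def IsProductOf {n : ℕ} {X : Type*} [TopologicalSpace X] (𝒰 : OrbifoldAtlas n X)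
    (a b r : RHat 𝒰) : Prop :=
  r.i = a.i ∧ r.j = b.j ∧
  ∃ lfi lfk : CC n → CC n,
    IsUSEmbedding (𝒰.chart r.k) (𝒰.chart a.k) lfi ∧
    IsUSEmbedding (𝒰.chart r.k) (𝒰.chart b.k) lfk ∧
    (∀ y ∈ (𝒰.chart r.k).Ut, a.lj (lfi y) = b.li (lfk y)) ∧
    lfi r.x = a.x ∧ lfk r.x = b.x ∧
    (∀ y ∈ (𝒰.chart r.k).Ut, r.li y = a.li (lfi y)) ∧
    (∀ y ∈ (𝒰.chart r.k).Ut, r.lj y = b.lj (lfk y))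

namespace UniformizingSystem

variable {n : ℕ} {X : Type*} [TopologicalSpace X]

/-- Elements of the structure group are embeddings of the system into itself. -/
lemma isUSEmbedding_of_mem (𝒰 : UniformizingSystem n X) {g : CC n → CC n} (hg : g ∈ 𝒰.G) :
    IsUSEmbedding 𝒰 𝒰 g := by
  obtain ⟨g', hg', hl, hr⟩ := 𝒰.inv_mem_G g hg
  have himage : g '' 𝒰.Ut = 𝒰.Ut :=
    (𝒰.mapsTo_G g hg).image_subset.antisymm
      fun x hx ↦ ⟨g' x, 𝒰.mapsTo_G g' hg' hx, hr x⟩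
  exact {
    mapsTo := 𝒰.mapsTo_G g hg
    injOn := (Function.LeftInverse.injective hl).injOn
    analyticOn := 𝒰.analytic_G g hg
    isOpen_image := by rw [himage]; exact 𝒰.isOpen_Ut
    exists_analytic_inv := ⟨g', by rw [himage]; exact 𝒰.analytic_G g' hg', fun x _ ↦ hl x⟩
    comp_p := 𝒰.invariant_p g hg }

end UniformizingSystem

namespace IsUSEmbedding

variable {n : ℕ} {X : Type*} [TopologicalSpace X] {𝒮 𝒰 𝒱 𝒲 : UniformizingSystem n X}

lemma comp {l m : CC n → CC n} (hm : IsUSEmbedding 𝒱 𝒲 m) (hl : IsUSEmbedding 𝒰 𝒱 l) :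
    IsUSEmbedding 𝒰 𝒲 (m ∘ l) := by
  obtain ⟨l', hl', hll'⟩ := hl.exists_analytic_inv
  obtain ⟨m', hm', hmm'⟩ := hm.exists_analytic_inv
  have himage : (m ∘ l) '' 𝒰.Ut = m '' 𝒱.Ut ∩ m' ⁻¹' (l '' 𝒰.Ut) := by
    ext y
    constructor
    · rintro ⟨x, hx, rfl⟩
      exact ⟨⟨l x, hl.mapsTo hx, rfl⟩, x, hx, (hmm' _ (hl.mapsTo hx)).symm⟩
    · rintro ⟨⟨z, hz, rfl⟩, x, hx, hxz⟩
      exact ⟨x, hx, by rw [Function.comp_apply, hxz, hmm' z hz]⟩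
  exact {
    mapsTo := hm.mapsTo.comp hl.mapsTo
    injOn := hm.injOn.comp hl.injOn hl.mapsTo
    analyticOn := hm.analyticOn.comp hl.analyticOn hl.mapsTo
    isOpen_image := himage ▸
      hm'.continuousOn.isOpen_inter_preimage hm.isOpen_image hl.isOpen_image
    exists_analytic_inv := by
      refine ⟨l' ∘ m', hl'.comp (hm'.mono ?_) ?_, fun x hx ↦ ?_⟩
      · exact himage ▸ inter_subset_left
      · rw [himage]
        exact fun y hy ↦ hy.2
      · simp only [Function.comp_apply]
        rw [hmm' _ (hl.mapsTo hx), hll' x hx]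
    comp_p := fun x hx ↦ (hm.comp_p _ (hl.mapsTo hx)).trans (hl.comp_p x hx) }

/-- An embedding can be corrected by the structure group of its target so as to send a given
point to a given point of the same fibre. -/
lemma exists_apply_eq {l : CC n → CC n} (hl : IsUSEmbedding 𝒰 𝒱 l) {x y : CC n}
    (hx : x ∈ 𝒰.Ut) (hy : y ∈ 𝒱.Ut) (hxy : 𝒰.p x = 𝒱.p y) :
    ∃ l', IsUSEmbedding 𝒰 𝒱 l' ∧ l' x = y := by
  obtain ⟨g, hg, hgy⟩ := 𝒱.exists_g_of_p_eq _ (hl.mapsTo hx) y hy ((hl.comp_p x hx).trans hxy)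
  exact ⟨g ∘ l, (𝒱.isUSEmbedding_of_mem hg).comp hl, hgy⟩

end IsUSEmbedding

/-- If, on a nonempty open subset of a connected open set, an analytic map agrees at each point
with one of finitely many analytic maps, then it agrees everywhere with one of them. -/
lemma exists_eqOn_of_forall_exists_eq {E F ι : Type*} [NormedAddCommGroup E] [NormedSpace ℂ E]
    [LocallyCompactSpace E] [NormedAddCommGroup F] [NormedSpace ℂ F] [Finite ι] {U O : Set E}
    (hU : IsPreconnected U) (hO : IsOpen O) (hOU : O ⊆ U) (hne : O.Nonempty) {f : E → F}
    (hf : AnalyticOnNhd ℂ f U) {g : ι → E → F} (hg : ∀ i, AnalyticOnNhd ℂ (g i) U)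
    (h : ∀ x ∈ O, ∃ i, f x = g i x) : ∃ i, EqOn f (g i) U := by
  have : LocallyCompactSpace O := hO.locallyCompactSpace
  have : Nonempty O := hne.to_subtype
  obtain ⟨i, z, hz⟩ := nonempty_interior_of_iUnion_of_closed
    (f := fun i ↦ {x : O | f x = g i x})
    (fun i ↦ isClosed_eq (continuousOn_iff_continuous_domRestrict.1 (hf.continuousOn.mono hOU))
      (continuousOn_iff_continuous_domRestrict.1 ((hg i).continuousOn.mono hOU)))
    (eq_univ_of_forall fun x ↦ mem_iUnion.2 (h x x.2))
  refine ⟨i, hf.eqOn_of_preconnected_of_eventuallyEq (hg i) hU (hOU z.2) ?_⟩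
  rw [← map_nhds_subtype_coe_eq_nhds z.2 (hO.mem_nhds z.2)]
  exact mem_interior_iff_mem_nhds.1 hz

/-- Let `l : 𝒰 → 𝒲` and `m : 𝒱 → 𝒲` be embeddings with `l x = m y`. An embedding `σ : 𝒮 → 𝒰`
through `x` can be completed to a commutative square by an embedding `𝒮 → 𝒱` through `y`, as soon
as `𝒮` embeds in `𝒱` at all. -/
lemma IsUSEmbedding.exists_comp_eq {n : ℕ} {X : Type*} [TopologicalSpace X]
    {𝒮 𝒰 𝒱 𝒲 : UniformizingSystem n X} {l m σ τ : CC n → CC n}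
    (hl : IsUSEmbedding 𝒰 𝒲 l) (hm : IsUSEmbedding 𝒱 𝒲 m) (hσ : IsUSEmbedding 𝒮 𝒰 σ)
    (hτ : IsUSEmbedding 𝒮 𝒱 τ) {s y : CC n} (hs : s ∈ 𝒮.Ut) (hy : y ∈ 𝒱.Ut)
    (h : l (σ s) = m y) :
    ∃ τ', IsUSEmbedding 𝒮 𝒱 τ' ∧ (∀ z ∈ 𝒮.Ut, l (σ z) = m (τ' z)) ∧ τ' s = y := by
  have hlσ := hl.comp hσ
  have hG (g : 𝒱.G) : IsUSEmbedding 𝒮 𝒱 (g.1 ∘ τ) := (𝒱.isUSEmbedding_of_mem g.2).comp hτ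
  have : Finite 𝒱.G := 𝒱.finite_G.to_subtype
  obtain ⟨g, hg⟩ := exists_eqOn_of_forall_exists_eq 𝒮.isConnected_Ut.isPreconnected
    (hlσ.analyticOn.continuousOn.isOpen_inter_preimage 𝒮.isOpen_Ut hm.isOpen_image)
    inter_subset_left ⟨s, hs, y, hy, h.symm⟩ hlσ.analyticOn
    (g := fun g : 𝒱.G ↦ m ∘ g.1 ∘ τ) (fun g ↦ (hm.comp (hG g)).analyticOn) (by
      rintro z ⟨hz, w, hw, hwz⟩
      obtain ⟨g, hg, hgw⟩ := 𝒱.exists_g_of_p_eq _ (hτ.mapsTo hz) w hw (by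
        rw [hτ.comp_p z hz, ← hm.comp_p w hw, hwz, hlσ.comp_p z hz])
      exact ⟨⟨g, hg⟩, by simp only [Function.comp_apply] at hwz ⊢; rw [hgw, hwz]⟩)
  exact ⟨g.1 ∘ τ, hG g, hg, hm.injOn ((hG g).mapsTo hs) hy ((hg hs).symm.trans h)⟩

/-- Four charts around a common point admit a common refinement around that point. -/
lemma OrbifoldAtlas.exists_common_refinement {n : ℕ} {X : Type*} [TopologicalSpace X]
    (𝒰 : OrbifoldAtlas n X) {i j k l : 𝒰.I} {x : X} (hi : x ∈ (𝒰.chart i).U)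
    (hj : x ∈ (𝒰.chart j).U) (hk : x ∈ (𝒰.chart k).U) (hl : x ∈ (𝒰.chart l).U) :
    ∃ s : 𝒰.I, x ∈ (𝒰.chart s).U ∧ (∃ f, IsUSEmbedding (𝒰.chart s) (𝒰.chart i) f) ∧
      (∃ f, IsUSEmbedding (𝒰.chart s) (𝒰.chart j) f) ∧
      (∃ f, IsUSEmbedding (𝒰.chart s) (𝒰.chart k) f) ∧
      (∃ f, IsUSEmbedding (𝒰.chart s) (𝒰.chart l) f) := by
  obtain ⟨c, hc, -, ⟨ci, hci⟩, ⟨cj, hcj⟩⟩ := 𝒰.compat i j x ⟨hi, hj⟩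
  obtain ⟨d, hd, -, ⟨dk, hdk⟩, ⟨dl, hdl⟩⟩ := 𝒰.compat k l x ⟨hk, hl⟩
  obtain ⟨s, hs, -, ⟨sc, hsc⟩, ⟨sd, hsd⟩⟩ := 𝒰.compat c d x ⟨hc, hd⟩
  exact ⟨s, hs, ⟨_, hci.comp hsc⟩, ⟨_, hcj.comp hsc⟩, ⟨_, hdk.comp hsd⟩, ⟨_, hdl.comp hsd⟩⟩

/-- Well-definedness of the multiplication `m` on `R := R̂/∼`: for composable triples
`a, b` (same middle chart and `λ_ij(x̃_i) = λ_kj(x̃_k)`), the `∼`-class of the product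
triple does not depend on the chosen completion, nor on the chosen representatives of
the `∼`-classes of `a` and `b`. -/
theorem statement14 {n : ℕ} {X : Type*} [TopologicalSpace X] [T2Space X]
    [SecondCountableTopology X] [ParacompactSpace X]
    (𝒰 : OrbifoldAtlas n X) (a b a' b' r r' : RHat 𝒰)
    (hcomp : a.j = b.i) (hpt : a.lj a.x = b.li b.x)
    (haa' : RRel 𝒰 a a') (hbb' : RRel 𝒰 b b')
    (hr : IsProductOf 𝒰 a b r) (hr' : IsProductOf 𝒰 a' b' r') :
    RRel 𝒰 r r' := by
  obtain ⟨hai, -, m, xm, hxm, ma, ma', hma, hma', hmi, hmj, hmx, hmx'⟩ := haa'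
  obtain ⟨-, hbj, q, xq, hxq, qb, qb', hqb, hqb', hqi, hqj, hqx, hqx'⟩ := hbb'
  obtain ⟨hri, hrj, fa, fb, hfa, hfb, hfj, hfax, hfbx, hrli, hrlj⟩ := hr
  obtain ⟨hri', hrj', fa', fb', hfa', hfb', hfj', hfax', hfbx', hrli', hrlj'⟩ := hr'
  have hpm : (𝒰.chart m).p xm = (𝒰.chart r.k).p r.x := by
    rw [← hma.comp_p _ hxm, hmx, ← hfax, hfa.comp_p _ r.hx]
  have hpq : (𝒰.chart q).p xq = (𝒰.chart r.k).p r.x := by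
    rw [← hqb.comp_p _ hxq, hqx, ← hfbx, hfb.comp_p _ r.hx]
  have hpr' : (𝒰.chart r'.k).p r'.x = (𝒰.chart r.k).p r.x := by
    rw [← hfa'.comp_p _ r'.hx, hfax', ← hmx', hma'.comp_p _ hxm, hpm]
  obtain ⟨s, ⟨xs, hxs, hps⟩, ⟨σ₀, hσ₀⟩, ⟨σ₀', hσ₀'⟩, ⟨μ₀, hμ₀⟩, ⟨κ₀, hκ₀⟩⟩ :=
    𝒰.exists_common_refinement ⟨r.x, r.hx, rfl⟩ ⟨r'.x, r'.hx, hpr'⟩ ⟨xm, hxm, hpm⟩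
      ⟨xq, hxq, hpq⟩
  obtain ⟨σ, hσ, hσx⟩ := hσ₀.exists_apply_eq hxs r.hx hps
  obtain ⟨μ, hμ, hσμ, hμx⟩ := hfa.exists_comp_eq hma hσ hμ₀ hxs hxm (by rw [hσx, hfax, hmx])
  obtain ⟨κ, hκ, hσκ, hκx⟩ := hfb.exists_comp_eq hqb hσ hκ₀ hxs hxq (by rw [hσx, hfbx, hqx])
  obtain ⟨σ', hσ', hμσ', hσx'⟩ :=
    hma'.exists_comp_eq hfa' hμ hσ₀' hxs r'.hx (by rw [hμx, hmx', hfax'])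
  have hκσ' : ∀ z ∈ (𝒰.chart s).Ut, qb' (κ z) = fb' (σ' z) := fun z hz ↦ by
    refine b'.hli.injOn (hqb'.mapsTo (hκ.mapsTo hz)) (hfb'.mapsTo (hσ'.mapsTo hz)) ?_
    rw [← hqi _ (hκ.mapsTo hz), ← hσκ z hz, ← hfj _ (hσ.mapsTo hz), hσμ z hz,
      hmj _ (hμ.mapsTo hz), hμσ' z hz, hfj' _ (hσ'.mapsTo hz)]
  refine ⟨by rw [hri, hri', hai], by rw [hrj, hrj', hbj], s, xs, hxs, σ, σ', hσ, hσ',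
    fun z hz ↦ ?_, fun z hz ↦ ?_, hσx, hσx'⟩
  · rw [hrli _ (hσ.mapsTo hz), hσμ z hz, hmi _ (hμ.mapsTo hz), hμσ' z hz,
      hrli' _ (hσ'.mapsTo hz)]
  · rw [hrlj _ (hσ.mapsTo hz), hσκ z hz, hqj _ (hκ.mapsTo hz), hκσ' z hz,
      hrlj' _ (hσ'.mapsTo hz)]
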